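/- Let Y_vec be the set of smooth space-compact maps ζ = (ζ⁰, ζ⃗) : ℝ×ℝ³ → ℝ×ℝ³ each of whose four components solves the wave equation ∂_t²ζ^μ = Δζ^μ, equipped with the symplectic form ω(ζ₁,ζ₂) := ∫_{ℝ³} ( ∂_tζ₁⁰(0,x) ζ₂⁰(0,x) − ζ₁⁰(0,x) ∂_tζ₂⁰(0,x) − ∂_tζ⃗₁(0,x)·ζ⃗₂(0,x) + ζ⃗₁(0,x)·∂_tζ⃗₂(0,x) ) dx. Let Y_Lor := {ζ ∈ Y_vec : ∂_tζ⁰ + div ζ⃗ = 0 everywhere} be the subspace cut out by the Lorentz condition. Then Y_Lor is coisotropic: if ξ ∈ Y_vec satisfies ω(ξ,ζ) = 0 for all ζ ∈ Y_Lor, then ξ ∈ Y_Lor, i.e. ∂_tξ⁰ + div ξ⃗ = 0 everywhere. -/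

import Mathlib

open Topology MeasureTheory

noncomputable section

/-- Physical space `ℝ³`. -/
abbrev Sp3 := EuclideanSpace ℝ (Fin 3)

/-- The `i`-th coordinate direction in `ℝ³`. -/
def sdir (i : Fin 3) : Sp3 := EuclideanSpace.single i 1

/-- Partial derivative of `f : ℝ³ → ℝ` in the `i`-th coordinate direction. -/
def pd (i : Fin 3) (f : Sp3 → ℝ) (x : Sp3) : ℝ := fderiv ℝ f x (sdir i)

/-- The Laplacian of `f : ℝ³ → ℝ`. -/
def lap (f : Sp3 → ℝ) (x : Sp3) : ℝ := ∑ i, pd i (fun y => pd i f y) x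

/-- A function on spacetime is space-compact if its (closed) support intersected with
every time slab `[-T,T] × ℝ³` is compact. -/
def SpaceCompact (f : ℝ → Sp3 → ℝ) : Prop :=
  ∀ T : ℝ, IsCompact (tsupport (fun p : ℝ × Sp3 => f p.1 p.2)
    ∩ Set.Icc (-T) T ×ˢ (Set.univ : Set Sp3))

/-- `(z0, zv)` is a smooth space-compact solution of the wave equation for
`ℝ^{1,3}`-valued functions on spacetime. -/
def IsVecWave (z0 : ℝ → Sp3 → ℝ) (zv : Fin 3 → ℝ → Sp3 → ℝ) : Prop :=
  ContDiff ℝ (⊤ : ℕ∞) (fun p : ℝ × Sp3 => z0 p.1 p.2) ∧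
  (∀ i, ContDiff ℝ (⊤ : ℕ∞) (fun p : ℝ × Sp3 => zv i p.1 p.2)) ∧
  SpaceCompact z0 ∧ (∀ i, SpaceCompact (zv i)) ∧
  (∀ (t : ℝ) (x : Sp3), deriv (deriv (fun r => z0 r x)) t = lap (z0 t) x) ∧
  (∀ (i : Fin 3) (t : ℝ) (x : Sp3),
    deriv (deriv (fun r => zv i r x)) t = lap (zv i t) x)

/-- The symplectic form on vector solutions of the wave equation, evaluated on the
time-zero slice; indices are contracted with the Minkowski metric. -/
def omegaVec (a0 : ℝ → Sp3 → ℝ) (av : Fin 3 → ℝ → Sp3 → ℝ)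
    (b0 : ℝ → Sp3 → ℝ) (bv : Fin 3 → ℝ → Sp3 → ℝ) : ℝ :=
  ∫ x : Sp3, (deriv (fun r => a0 r x) 0 * b0 0 x - a0 0 x * deriv (fun r => b0 r x) 0
    - ∑ i, deriv (fun r => av i r x) 0 * bv i 0 x
    + ∑ i, av i 0 x * deriv (fun r => bv i r x) 0)

/-- The derivative of a function on spacetime in the direction `v`. -/
def dirDeriv (v : ℝ × Sp3) (F : ℝ × Sp3 → ℝ) (p : ℝ × Sp3) : ℝ := fderiv ℝ F p v

/-- The unit vector in the time direction. -/
def timeDir : ℝ × Sp3 := (1, 0)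

/-- The unit vector in the `i`-th spatial direction of spacetime. -/
def spaceDir (i : Fin 3) : ℝ × Sp3 := (0, sdir i)

/-- Smooth functions on spacetime whose support meets every time slab in a compact set. -/
structure SmoothSpaceCompact (F : ℝ × Sp3 → ℝ) : Prop where
  contDiff : ContDiff ℝ (⊤ : ℕ∞) F
  isCompact : ∀ T : ℝ, IsCompact (tsupport F ∩ Set.Icc (-T) T ×ˢ (Set.univ : Set Sp3))

/-- Functions on spacetime satisfying the wave equation. -/
def IsWave (F : ℝ × Sp3 → ℝ) : Prop :=
  dirDeriv timeDir (dirDeriv timeDir F) =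
    ∑ i, dirDeriv (spaceDir i) (dirDeriv (spaceDir i) F)

section dirDeriv

variable {F G : ℝ × Sp3 → ℝ}

theorem ContDiff.dirDeriv (hF : ContDiff ℝ (⊤ : ℕ∞) F) (v : ℝ × Sp3) :
    ContDiff ℝ (⊤ : ℕ∞) (dirDeriv v F) :=
  (hF.fderiv_right (m := (⊤ : ℕ∞)) (by simp)).clm_apply contDiff_const

theorem dirDeriv_comm (hF : ContDiff ℝ (⊤ : ℕ∞) F) (v w : ℝ × Sp3) :
    dirDeriv v (dirDeriv w F) = dirDeriv w (dirDeriv v F) := by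
  funext p
  have hd : DifferentiableAt ℝ (fderiv ℝ F) p :=
    (hF.fderiv_right (m := (⊤ : ℕ∞)) (by simp)).differentiable (by simp) p
  have key : ∀ a b : ℝ × Sp3,
      dirDeriv a (dirDeriv b F) p = fderiv ℝ (fderiv ℝ F) p a b := by
    intro a b
    have h := (hd.hasFDerivAt.clm_apply (hasFDerivAt_const b p)).fderiv
    change fderiv ℝ (fun q => fderiv ℝ F q b) p a = _
    rw [h]
    simp
  rw [key, key]
  exact (hF.contDiffAt.isSymmSndFDerivAt (by
    rw [minSmoothness_of_isRCLikeNormedField]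
    exact WithTop.coe_le_coe.2 le_top)).eq v w

theorem dirDeriv_add (hF : ContDiff ℝ (⊤ : ℕ∞) F) (hG : ContDiff ℝ (⊤ : ℕ∞) G)
    (v : ℝ × Sp3) : dirDeriv v (F + G) = dirDeriv v F + dirDeriv v G := by
  funext p
  simp only [dirDeriv, Pi.add_apply]
  rw [fderiv_add (hF.differentiable (by simp) p) (hG.differentiable (by simp) p)]
  rfl

theorem dirDeriv_neg (v : ℝ × Sp3) : dirDeriv v (-F) = -dirDeriv v F := by
  funext p
  simp [dirDeriv, fderiv_neg]

theorem dirDeriv_sub (hF : ContDiff ℝ (⊤ : ℕ∞) F) (hG : ContDiff ℝ (⊤ : ℕ∞) G)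
    (v : ℝ × Sp3) : dirDeriv v (F - G) = dirDeriv v F - dirDeriv v G := by
  rw [sub_eq_add_neg, dirDeriv_add hF (G := -G) hG.neg, dirDeriv_neg, sub_eq_add_neg]

theorem dirDeriv_mul (hF : ContDiff ℝ (⊤ : ℕ∞) F) (hG : ContDiff ℝ (⊤ : ℕ∞) G)
    (v : ℝ × Sp3) : dirDeriv v (F * G) = dirDeriv v F * G + F * dirDeriv v G := by
  funext p
  simp only [dirDeriv, Pi.add_apply, Pi.mul_apply]
  rw [fderiv_mul (hF.differentiable (by simp) p) (hG.differentiable (by simp) p)]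
  simp
  ring

theorem dirDeriv_sum {ι : Type*} {s : Finset ι} {H : ι → ℝ × Sp3 → ℝ}
    (hH : ∀ i, ContDiff ℝ (⊤ : ℕ∞) (H i)) (v : ℝ × Sp3) :
    dirDeriv v (∑ i ∈ s, H i) = ∑ i ∈ s, dirDeriv v (H i) := by
  funext p
  simp only [dirDeriv, Finset.sum_apply]
  rw [fderiv_sum fun i _ => (hH i).differentiable (by simp) p]
  simp

theorem hasDerivAt_time_slice (hF : ContDiff ℝ (⊤ : ℕ∞) F) (t : ℝ) (x : Sp3) :
    HasDerivAt (fun r => F (r, x)) (dirDeriv timeDir F (t, x)) t :=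
  (hF.differentiable (by simp) (t, x)).hasFDerivAt.comp_hasDerivAt t
    ((hasDerivAt_id t).prodMk (hasDerivAt_const t x))

theorem deriv_time_slice (hF : ContDiff ℝ (⊤ : ℕ∞) F) (t : ℝ) (x : Sp3) :
    deriv (fun r => F (r, x)) t = dirDeriv timeDir F (t, x) :=
  (hasDerivAt_time_slice hF t x).deriv

theorem pd_space_slice (hF : ContDiff ℝ (⊤ : ℕ∞) F) (i : Fin 3) (t : ℝ) (x : Sp3) :
    pd i (fun y => F (t, y)) x = dirDeriv (spaceDir i) F (t, x) := by
  have h := (hF.differentiable (by simp) (t, x)).hasFDerivAt.comp x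
    ((hasFDerivAt_const t x).prodMk (hasFDerivAt_id x))
  change fderiv ℝ (F ∘ fun y => (t, y)) x (sdir i) = _
  have h' : fderiv ℝ (F ∘ fun y => (t, y)) x = _ := h.fderiv
  rw [h']
  simp [dirDeriv, spaceDir]

theorem isWave_iff_slices (hF : ContDiff ℝ (⊤ : ℕ∞) F) :
    IsWave F ↔ ∀ t x, deriv (deriv fun r => F (r, x)) t = lap (fun y => F (t, y)) x := by
  have h₁ : ∀ t x, deriv (deriv fun r => F (r, x)) t =
      dirDeriv timeDir (dirDeriv timeDir F) (t, x) := by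
    intro t x
    rw [funext fun s => deriv_time_slice hF s x, deriv_time_slice (hF.dirDeriv _)]
  have h₂ : ∀ t x, lap (fun y => F (t, y)) x =
      (∑ i, dirDeriv (spaceDir i) (dirDeriv (spaceDir i) F)) (t, x) := by
    intro t x
    rw [lap, Finset.sum_apply]
    refine Finset.sum_congr rfl fun i _ => ?_
    rw [funext fun y => pd_space_slice hF i t y, pd_space_slice (hF.dirDeriv _)]
  simp only [h₁, h₂, IsWave, funext_iff, Prod.forall]

theorem IsWave.dirDeriv (hF : ContDiff ℝ (⊤ : ℕ∞) F) (hw : IsWave F) (v : ℝ × Sp3) :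
    IsWave (dirDeriv v F) := by
  have key : ∀ w, _root_.dirDeriv w (_root_.dirDeriv w (_root_.dirDeriv v F)) =
      _root_.dirDeriv v (_root_.dirDeriv w (_root_.dirDeriv w F)) := fun w => by
    rw [dirDeriv_comm hF w v, dirDeriv_comm (hF.dirDeriv w) w v]
  unfold IsWave at hw ⊢
  simp only [key]
  rw [hw, dirDeriv_sum fun i => (hF.dirDeriv _).dirDeriv _]

theorem IsWave.add (hF : ContDiff ℝ (⊤ : ℕ∞) F) (hG : ContDiff ℝ (⊤ : ℕ∞) G)
    (hwF : IsWave F) (hwG : IsWave G) : IsWave (F + G) := by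
  have key : ∀ w, _root_.dirDeriv w (_root_.dirDeriv w (F + G)) =
      _root_.dirDeriv w (_root_.dirDeriv w F) + _root_.dirDeriv w (_root_.dirDeriv w G) :=
    fun w => by rw [dirDeriv_add hF hG, dirDeriv_add (hF.dirDeriv w) (hG.dirDeriv w)]
  unfold IsWave at hwF hwG ⊢
  simp only [key]
  rw [hwF, hwG, Finset.sum_add_distrib]

theorem IsWave.neg (hw : IsWave F) : IsWave (-F) := by
  unfold IsWave at hw ⊢
  simp only [dirDeriv_neg]
  rw [hw, Finset.sum_neg_distrib]

end dirDeriv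

namespace SmoothSpaceCompact

variable {F G : ℝ × Sp3 → ℝ}

theorem of_tsupport_subset (hF : SmoothSpaceCompact F) (hG : ContDiff ℝ (⊤ : ℕ∞) G)
    (h : tsupport G ⊆ tsupport F) : SmoothSpaceCompact G :=
  ⟨hG, fun T => (hF.isCompact T).of_isClosed_subset
    ((isClosed_tsupport G).inter (isClosed_Icc.prod isClosed_univ))
    (Set.inter_subset_inter_left _ h)⟩

theorem dirDeriv (hF : SmoothSpaceCompact F) (v : ℝ × Sp3) :
    SmoothSpaceCompact (dirDeriv v F) :=
  hF.of_tsupport_subset (hF.contDiff.dirDeriv v) (tsupport_fderiv_apply_subset ℝ v)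

theorem mul (hF : SmoothSpaceCompact F) (hG : SmoothSpaceCompact G) :
    SmoothSpaceCompact (F * G) :=
  hF.of_tsupport_subset (hF.contDiff.mul hG.contDiff) tsupport_mul_subset_left

theorem neg (hF : SmoothSpaceCompact F) : SmoothSpaceCompact (-F) :=
  hF.of_tsupport_subset hF.contDiff.neg (tsupport_neg F).subset

theorem add (hF : SmoothSpaceCompact F) (hG : SmoothSpaceCompact G) :
    SmoothSpaceCompact (F + G) :=
  ⟨hF.contDiff.add hG.contDiff, fun T =>
    ((hF.isCompact T).union (hG.isCompact T)).of_isClosed_subset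
      ((isClosed_tsupport _).inter (isClosed_Icc.prod isClosed_univ)) <| by
      rw [← Set.union_inter_distrib_right]
      exact Set.inter_subset_inter_left _ (tsupport_add F G)⟩

theorem sub (hF : SmoothSpaceCompact F) (hG : SmoothSpaceCompact G) :
    SmoothSpaceCompact (F - G) := by
  rw [sub_eq_add_neg]
  exact hF.add hG.neg

theorem sum_fin_three {H : Fin 3 → ℝ × Sp3 → ℝ} (hH : ∀ i, SmoothSpaceCompact (H i)) :
    SmoothSpaceCompact (∑ i, H i) := by
  rw [Fin.sum_univ_three]
  exact ((hH 0).add (hH 1)).add (hH 2)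

theorem exists_isCompact_slab (hF : SmoothSpaceCompact F) (T : ℝ) :
    ∃ K : Set Sp3, IsCompact K ∧ ∀ t ∈ Set.Icc (-T) T, ∀ x ∉ K, F (t, x) = 0 := by
  refine ⟨Prod.snd '' (tsupport F ∩ Set.Icc (-T) T ×ˢ Set.univ),
    (hF.isCompact T).image continuous_snd, fun t ht x hx => ?_⟩
  by_contra h
  exact hx ⟨(t, x), ⟨subset_tsupport F h, ht, trivial⟩, rfl⟩

theorem hasCompactSupport_slice (hF : SmoothSpaceCompact F) (t : ℝ) :
    HasCompactSupport fun x => F (t, x) := by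
  obtain ⟨K, hK, h⟩ := hF.exists_isCompact_slab |t|
  exact HasCompactSupport.intro hK (h t ⟨neg_abs_le t, le_abs_self t⟩)

theorem continuous_slice (hF : SmoothSpaceCompact F) (t : ℝ) :
    Continuous fun x => F (t, x) :=
  hF.contDiff.continuous.comp (by fun_prop)

theorem integrable_slice (hF : SmoothSpaceCompact F) (t : ℝ) :
    Integrable fun x => F (t, x) :=
  (hF.continuous_slice t).integrable_of_hasCompactSupport (hF.hasCompactSupport_slice t)

theorem integral_dirDeriv_spaceDir (hF : SmoothSpaceCompact F) (i : Fin 3) (t : ℝ) :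
    ∫ x, _root_.dirDeriv (spaceDir i) F (t, x) = 0 := by
  have hd : Differentiable ℝ fun x => F (t, x) :=
    (hF.contDiff.differentiable (by simp)).comp (by fun_prop)
  have hpd : ∀ x, fderiv ℝ (fun y => F (t, y)) x (sdir i) =
      _root_.dirDeriv (spaceDir i) F (t, x) := pd_space_slice hF.contDiff i t
  have h := integral_mul_fderiv_eq_neg_fderiv_mul_of_integrable (μ := (volume : Measure Sp3))
    (f := fun _ => (1 : ℝ)) (g := fun x => F (t, x)) (v := sdir i)
    (by simp) (by simpa [hpd] using (hF.dirDeriv _).integrable_slice t)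
    (by simpa using hF.integrable_slice t) (fun x _ => differentiableAt_const _)
    (fun x _ => hd x)
  simpa [hpd] using h

theorem integral_add_divergence {E : ℝ × Sp3 → ℝ} (hE : SmoothSpaceCompact E)
    {W : Fin 3 → ℝ × Sp3 → ℝ} (hW : ∀ i, SmoothSpaceCompact (W i)) (t : ℝ) :
    ∫ x, (E (t, x) + ∑ i, _root_.dirDeriv (spaceDir i) (W i) (t, x)) = ∫ x, E (t, x) := by
  have hi : ∀ i, Integrable fun x => _root_.dirDeriv (spaceDir i) (W i) (t, x) :=
    fun i => ((hW i).dirDeriv _).integrable_slice t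
  rw [integral_add (hE.integrable_slice t) (integrable_finsetSum _ fun i _ => hi i),
    integral_finsetSum _ fun i _ => hi i]
  simp [(hW _).integral_dirDeriv_spaceDir]

theorem hasDerivAt_integral_slice (hF : SmoothSpaceCompact F) (t : ℝ) :
    HasDerivAt (fun s => ∫ x, F (s, x)) (∫ x, _root_.dirDeriv timeDir F (t, x)) t := by
  have hF' := hF.dirDeriv timeDir
  obtain ⟨K, hK, hzero⟩ := hF'.exists_isCompact_slab (|t| + 1)
  obtain ⟨C, hC⟩ := ((isCompact_Icc (a := -(|t| + 1))
    (b := |t| + 1)).prod hK).exists_bound_of_continuousOn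
    hF'.contDiff.continuous.continuousOn
  have hball : ∀ s ∈ Metric.ball t 1, s ∈ Set.Icc (-(|t| + 1)) (|t| + 1) := by
    intro s hs
    rw [Metric.mem_ball, Real.dist_eq, abs_lt] at hs
    have h₁ := neg_abs_le t
    have h₂ := le_abs_self t
    constructor <;> linarith
  refine (hasDerivAt_integral_of_dominated_loc_of_deriv_le
    (F := fun s x => F (s, x)) (F' := fun s x => _root_.dirDeriv timeDir F (s, x))
    (bound := K.indicator fun _ => C)
    (Metric.ball_mem_nhds t one_pos)
    (.of_forall fun s => (hF.continuous_slice s).aestronglyMeasurable)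
    (hF.integrable_slice t) (hF'.continuous_slice t).aestronglyMeasurable
    (.of_forall fun x s hs => ?_) ?_
    (.of_forall fun x s _ => hasDerivAt_time_slice hF.contDiff s x)).2
  · by_cases hx : x ∈ K
    · simpa [hx] using hC (s, x) ⟨hball s hs, hx⟩
    · simp [hx, hzero s (hball s hs) x hx]
  · exact (integrable_indicator_iff hK.measurableSet).2
      (integrableOn_const hK.measure_lt_top.ne)

end SmoothSpaceCompact

/-- Twice the energy density of a function on spacetime. -/
def energyDensity (F : ℝ × Sp3 → ℝ) : ℝ × Sp3 → ℝ :=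
  dirDeriv timeDir F * dirDeriv timeDir F +
    ∑ i, dirDeriv (spaceDir i) F * dirDeriv (spaceDir i) F

theorem SmoothSpaceCompact.energyDensity {F : ℝ × Sp3 → ℝ} (hF : SmoothSpaceCompact F) :
    SmoothSpaceCompact (energyDensity F) :=
  ((hF.dirDeriv _).mul (hF.dirDeriv _)).add
    (sum_fin_three fun i => (hF.dirDeriv (spaceDir i)).mul (hF.dirDeriv _))

theorem energyDensity_apply (F : ℝ × Sp3 → ℝ) (p : ℝ × Sp3) :
    energyDensity F p = dirDeriv timeDir F p ^ 2 + ∑ i, dirDeriv (spaceDir i) F p ^ 2 := by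
  simp [energyDensity, sq]

/-- The energy of a space-compact solution of the wave equation is conserved. -/
theorem integral_energyDensity_eq {F : ℝ × Sp3 → ℝ} (hF : SmoothSpaceCompact F)
    (hw : IsWave F) (s t : ℝ) :
    ∫ x, energyDensity F (s, x) = ∫ x, energyDensity F (t, x) := by
  refine is_const_of_deriv_eq_zero
    (fun r => (hF.energyDensity.hasDerivAt_integral_slice r).differentiableAt) (fun r => ?_) s t
  rw [(hF.energyDensity.hasDerivAt_integral_slice r).deriv]
  have hd := fun v => hF.contDiff.dirDeriv v
  have hflux : ∀ i, SmoothSpaceCompact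
      (dirDeriv timeDir F * dirDeriv (spaceDir i) F +
        dirDeriv timeDir F * dirDeriv (spaceDir i) F) :=
    fun i => ((hF.dirDeriv _).mul (hF.dirDeriv _)).add ((hF.dirDeriv _).mul (hF.dirDeriv _))
  have h0 : SmoothSpaceCompact (0 : ℝ × Sp3 → ℝ) := by simpa using hF.sub hF
  have h := h0.integral_add_divergence hflux r
  rw [← (h.trans (by simp) : _ = (0 : ℝ))]
  congr 1
  funext x
  have hwx := congrFun hw (r, x)
  have hcomm := fun i => dirDeriv_comm hF.contDiff (spaceDir i) timeDir
  have hsq : ∀ v, ContDiff ℝ (⊤ : ℕ∞) (dirDeriv v F * dirDeriv v F) :=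
    fun v => (hd v).mul (hd v)
  have htx : ∀ i, ContDiff ℝ (⊤ : ℕ∞) (dirDeriv timeDir F * dirDeriv (spaceDir i) F) :=
    fun i => (hd timeDir).mul (hd (spaceDir i))
  rw [energyDensity, dirDeriv_add (hsq _)
      (SmoothSpaceCompact.sum_fin_three fun i =>
        (hF.dirDeriv (spaceDir i)).mul (hF.dirDeriv _)).contDiff,
    dirDeriv_sum fun i => hsq (spaceDir i)]
  simp only [dirDeriv_add (htx _) (htx _), dirDeriv_mul (hd _) (hd _), hcomm,
    Pi.add_apply, Pi.mul_apply, Finset.sum_apply, Fin.sum_univ_three, Pi.zero_apply] at hwx ⊢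
  rw [hwx]
  ring

/-- A space-compact solution of the wave equation with zero initial energy vanishes. -/
theorem eq_zero_of_integral_energyDensity_eq_zero {F : ℝ × Sp3 → ℝ}
    (hF : SmoothSpaceCompact F) (hw : IsWave F)
    (h : ∫ x, energyDensity F (0, x) = 0) (t : ℝ) (x : Sp3) : F (t, x) = 0 := by
  have hpos : ∀ p, 0 ≤ energyDensity F p := fun p => by
    rw [energyDensity_apply]
    positivity
  have hzero : ∀ y, energyDensity F (t, y) = 0 := by
    intro y
    by_contra hy
    have := (hF.energyDensity.continuous_slice t).integral_pos_of_hasCompactSupport_nonneg_nonzero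
      (μ := volume) (hF.energyDensity.hasCompactSupport_slice t) (fun z => hpos _) hy
    rw [integral_energyDensity_eq hF hw t 0, h] at this
    exact lt_irrefl _ this
  have hgrad : ∀ y i, pd i (fun z => F (t, z)) y = 0 := by
    intro y i
    have hy := hzero y
    rw [energyDensity_apply, add_eq_zero_iff_of_nonneg (by positivity) (by positivity),
      Finset.sum_eq_zero_iff_of_nonneg fun _ _ => by positivity] at hy
    rw [pd_space_slice hF.contDiff]
    exact pow_eq_zero_iff two_ne_zero |>.1 (hy.2 i (Finset.mem_univ i))
  have hd : Differentiable ℝ fun z => F (t, z) :=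
    (hF.contDiff.differentiable (by simp)).comp (by fun_prop)
  have hfderiv : ∀ y, fderiv ℝ (fun z => F (t, z)) y = 0 := by
    intro y
    refine ContinuousLinearMap.coe_injective
      ((EuclideanSpace.basisFun (Fin 3) ℝ).toBasis.ext fun i => ?_)
    simpa [pd, sdir] using hgrad y i
  obtain ⟨y, hy⟩ : ∃ y, F (t, y) = 0 := by
    by_contra! hne
    have hu : tsupport (fun z => F (t, z)) = Set.univ :=
      Set.eq_univ_of_forall fun z => subset_tsupport _ (hne z)
    exact noncompact_univ Sp3 (hu ▸ hF.hasCompactSupport_slice t)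
  exact (is_const_of_fderiv_eq_zero hd hfderiv x y).trans hy

/-- The subspace cut out by the Lorentz condition is coisotropic in the symplectic
space of vector solutions of the wave equation. -/
theorem stmt_9 (ξ0 : ℝ → Sp3 → ℝ) (ξv : Fin 3 → ℝ → Sp3 → ℝ)
    (hξ : IsVecWave ξ0 ξv)
    (horth : ∀ (z0 : ℝ → Sp3 → ℝ) (zv : Fin 3 → ℝ → Sp3 → ℝ),
      IsVecWave z0 zv →
      (∀ (t : ℝ) (x : Sp3), deriv (fun r => z0 r x) t + ∑ i, pd i (zv i t) x = 0) →
      omegaVec ξ0 ξv z0 zv = 0) :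
    ∀ (t : ℝ) (x : Sp3), deriv (fun r => ξ0 r x) t + ∑ i, pd i (ξv i t) x = 0 := by
  obtain ⟨hs0, hsv, hc0, hcv, hw0, hwv⟩ := hξ
  set X : ℝ × Sp3 → ℝ := fun p => ξ0 p.1 p.2
  set Y : Fin 3 → ℝ × Sp3 → ℝ := fun i p => ξv i p.1 p.2
  have hXc : SmoothSpaceCompact X := ⟨hs0, hc0⟩
  have hYc : ∀ i, SmoothSpaceCompact (Y i) := fun i => ⟨hsv i, hcv i⟩
  have hXw : IsWave X := (isWave_iff_slices hs0).2 hw0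
  have hYw : ∀ i, IsWave (Y i) := fun i => (isWave_iff_slices (hsv i)).2 (hwv i)
  have hYs := fun i => (hYc i).contDiff
  obtain ⟨L, hL⟩ : ∃ L, L = dirDeriv timeDir X + ∑ i, dirDeriv (spaceDir i) (Y i) := ⟨_, rfl⟩
  have hLc : SmoothSpaceCompact L := by
    rw [hL]
    exact (hXc.dirDeriv _).add (.sum_fin_three fun i => (hYc i).dirDeriv _)
  have hLw : IsWave L := by
    have hYd := fun i => (hYs i).dirDeriv (spaceDir i)
    have hYdw := fun i => (hYw i).dirDeriv (hYs i) (spaceDir i)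
    rw [hL, Fin.sum_univ_three]
    exact (hXw.dirDeriv hs0 _).add (hs0.dirDeriv _) (((hYd 0).add (hYd 1)).add (hYd 2))
      (((hYdw 0).add (hYd 0) (hYd 1) (hYdw 1)).add ((hYd 0).add (hYd 1)) (hYd 2) (hYdw 2))
  have hgoal : ∀ t x, deriv (fun r => ξ0 r x) t + ∑ i, pd i (ξv i t) x = L (t, x) := by
    intro t x
    have h₁ : deriv (fun r => ξ0 r x) t = _ := deriv_time_slice hs0 t x
    have h₂ : ∀ i, pd i (ξv i t) x = _ := fun i => pd_space_slice (hYs i) i t x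
    rw [h₁, hL]
    simp only [h₂, Pi.add_apply, Finset.sum_apply]
  intro t x
  rw [hgoal]
  refine eq_zero_of_integral_energyDensity_eq_zero hLc hLw ?_ t x
  -- Test against the pure gauge field generated by `Λ = ∂ₜ L`.
  obtain ⟨Λ, hΛ⟩ : ∃ Λ, Λ = dirDeriv timeDir L := ⟨_, rfl⟩
  have hΛc : SmoothSpaceCompact Λ := hΛ ▸ hLc.dirDeriv _
  have hΛw : IsWave Λ := hΛ ▸ hLw.dirDeriv hLc.contDiff _
  have hz0 : SmoothSpaceCompact (-dirDeriv timeDir Λ) := (hΛc.dirDeriv _).neg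
  have hzv : ∀ i, SmoothSpaceCompact (dirDeriv (spaceDir i) Λ) := fun i => hΛc.dirDeriv _
  have horth' := horth (fun t x => (-dirDeriv timeDir Λ) (t, x))
    (fun i t x => dirDeriv (spaceDir i) Λ (t, x))
    ⟨hz0.contDiff, fun i => (hzv i).contDiff, hz0.isCompact, fun i => (hzv i).isCompact,
      (isWave_iff_slices hz0.contDiff).1 (hΛw.dirDeriv hΛc.contDiff _).neg,
      fun i => (isWave_iff_slices (hzv i).contDiff).1 (hΛw.dirDeriv hΛc.contDiff _)⟩
    (fun t x => by
      rw [deriv_time_slice hz0.contDiff, dirDeriv_neg, hΛw]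
      simp [pd_space_slice (hzv _).contDiff])
  -- The symplectic form differs from the energy of `L` by the divergence of `W`.
  obtain ⟨W, hW⟩ : ∃ W : Fin 3 → ℝ × Sp3 → ℝ, ∀ i, W i =
      X * dirDeriv (spaceDir i) Λ - dirDeriv (spaceDir i) X * Λ - dirDeriv timeDir (Y i) * Λ
        + Y i * dirDeriv timeDir Λ - L * dirDeriv (spaceDir i) L := ⟨_, fun _ => rfl⟩
  have hWc : ∀ i, SmoothSpaceCompact (W i) := fun i => hW i ▸
    ((((hXc.mul (hΛc.dirDeriv _)).sub ((hXc.dirDeriv _).mul hΛc)).sub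
      (((hYc i).dirDeriv _).mul hΛc)).add ((hYc i).mul (hΛc.dirDeriv _))).sub
      (hLc.mul (hLc.dirDeriv _))
  refine (hLc.energyDensity.integral_add_divergence hWc 0).symm.trans (Eq.trans ?_ horth')
  rw [omegaVec]
  congr 1
  funext x
  have e₁ : deriv (fun r => ξ0 r x) 0 = dirDeriv timeDir X (0, x) := deriv_time_slice hs0 0 x
  have e₂ : ∀ i, deriv (fun r => ξv i r x) 0 = dirDeriv timeDir (Y i) (0, x) :=
    fun i => deriv_time_slice (hYs i) 0 x
  have e₃ : ξ0 0 x = X (0, x) := rfl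
  have e₄ : ∀ i, ξv i 0 x = Y i (0, x) := fun i => rfl
  have hdW : ∀ i, dirDeriv (spaceDir i) (W i) (0, x) =
      X (0, x) * dirDeriv (spaceDir i) (dirDeriv (spaceDir i) Λ) (0, x)
      - dirDeriv (spaceDir i) (dirDeriv (spaceDir i) X) (0, x) * Λ (0, x)
      - dirDeriv timeDir (dirDeriv (spaceDir i) (Y i)) (0, x) * Λ (0, x)
      - dirDeriv timeDir (Y i) (0, x) * dirDeriv (spaceDir i) Λ (0, x)
      + dirDeriv (spaceDir i) (Y i) (0, x) * dirDeriv timeDir Λ (0, x)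
      + Y i (0, x) * dirDeriv timeDir (dirDeriv (spaceDir i) Λ) (0, x)
      - dirDeriv (spaceDir i) L (0, x) ^ 2
      - L (0, x) * dirDeriv (spaceDir i) (dirDeriv (spaceDir i) L) (0, x) := by
    intro i
    have c₁ := hXc.mul (hΛc.dirDeriv (spaceDir i))
    have c₂ := (hXc.dirDeriv (spaceDir i)).mul hΛc
    have c₃ := ((hYc i).dirDeriv timeDir).mul hΛc
    have c₄ := (hYc i).mul (hΛc.dirDeriv timeDir)
    have c₅ := hLc.mul (hLc.dirDeriv (spaceDir i))
    rw [hW, dirDeriv_sub (((c₁.sub c₂).sub c₃).add c₄).contDiff c₅.contDiff,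
      dirDeriv_add ((c₁.sub c₂).sub c₃).contDiff c₄.contDiff,
      dirDeriv_sub (c₁.sub c₂).contDiff c₃.contDiff, dirDeriv_sub c₁.contDiff c₂.contDiff,
      dirDeriv_mul hXc.contDiff (hΛc.contDiff.dirDeriv _),
      dirDeriv_mul (hXc.contDiff.dirDeriv _) hΛc.contDiff,
      dirDeriv_mul ((hYs i).dirDeriv _) hΛc.contDiff,
      dirDeriv_mul (hYs i) (hΛc.contDiff.dirDeriv _),
      dirDeriv_mul hLc.contDiff (hLc.contDiff.dirDeriv _),
      dirDeriv_comm (hYs i) (spaceDir i) timeDir,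
      dirDeriv_comm hΛc.contDiff (spaceDir i) timeDir]
    simp only [Pi.add_apply, Pi.sub_apply, Pi.mul_apply]
    ring
  have hLx : L (0, x) = _ := congrFun hL (0, x)
  have hΛx : Λ (0, x) = dirDeriv timeDir (dirDeriv timeDir X) (0, x) +
      ∑ i, dirDeriv timeDir (dirDeriv (spaceDir i) (Y i)) (0, x) := by
    have hYd := fun i => (hYs i).dirDeriv (spaceDir i)
    rw [hΛ, hL, dirDeriv_add (hs0.dirDeriv _) (SmoothSpaceCompact.sum_fin_three fun i =>
        (hYc i).dirDeriv (spaceDir i)).contDiff, dirDeriv_sum hYd,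
      Pi.add_apply, Finset.sum_apply]
  have hXx := congrFun hXw (0, x)
  have hLwx : dirDeriv timeDir Λ (0, x) = _ := hΛ ▸ congrFun hLw (0, x)
  have hΛwx := congrFun hΛw (0, x)
  have hΛL : dirDeriv timeDir L (0, x) = Λ (0, x) := congrFun hΛ.symm _
  rw [energyDensity_apply, deriv_time_slice hz0.contDiff, dirDeriv_neg]
  simp only [e₁, e₂, e₃, e₄, hdW, deriv_time_slice (hzv _).contDiff, hΛL, Pi.neg_apply,
    Pi.add_apply, Finset.sum_apply, Fin.sum_univ_three] at hLx hΛx hXx hLwx hΛwx ⊢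
  linear_combination -X (0, x) * hΛwx + L (0, x) * hLwx - dirDeriv timeDir Λ (0, x) * hLx
    + Λ (0, x) * hΛx + Λ (0, x) * hXx

end
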